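/- If constant coefficients a_{αβ}^{ij} (α,β ∈ {1,…,N}, i,j ∈ {1,…,m}) satisfy the Legendre–Hadamard condition with constant θ > 0, then for every u in the m-fold product of H^1_0(Ω) (Ω a bounded open set in ℝ^N), the bilinear form satisfies ∫_Ω Σ a_{αβ}^{ij} (∂u_i/∂x_α)(∂u_j/∂x_β) dx ≥ θ ∫_Ω Σ_i |∇u_i|² dx. (Gårding-type coercivity via Fourier transform/Plancherel for compactly supported functions.) -/

import Mathlib

open MeasureTheory

open scoped FourierTransform SchwartzMap LineDeriv InnerProductSpace

section FormIntegral

variable {ι κ X : Type*} [Fintype ι] [Fintype κ] [MeasurableSpace X] {μ : Measure X}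

theorem integral_sum_mul_re_inner {f : ι → κ → X → ℂ}
    (hf : ∀ α i β j, Integrable (fun x ↦ ⟪f α i x, f β j x⟫_ℂ) μ) (b : ι → ι → κ → κ → ℝ) :
    ∫ x, ∑ α, ∑ β, ∑ i, ∑ j, b α β i j * (⟪f α i x, f β j x⟫_ℂ).re ∂μ =
      ∑ α, ∑ β, ∑ i, ∑ j, b α β i j * (∫ x, ⟪f α i x, f β j x⟫_ℂ ∂μ).re := by
  have hint (α β i j) : Integrable (fun x ↦ b α β i j * (⟪f α i x, f β j x⟫_ℂ).re) μ :=
    (hf α i β j).re.const_mul _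
  rw [integral_finsetSum _ fun α _ ↦ integrable_finsetSum _ fun β _ ↦ integrable_finsetSum _
    fun i _ ↦ integrable_finsetSum _ fun j _ ↦ hint α β i j]
  refine Finset.sum_congr rfl fun α _ ↦ ?_
  rw [integral_finsetSum _ fun β _ ↦ integrable_finsetSum _
    fun i _ ↦ integrable_finsetSum _ fun j _ ↦ hint α β i j]
  refine Finset.sum_congr rfl fun β _ ↦ ?_
  rw [integral_finsetSum _ fun i _ ↦ integrable_finsetSum _ fun j _ ↦ hint α β i j]
  refine Finset.sum_congr rfl fun i _ ↦ ?_
  rw [integral_finsetSum _ fun j _ ↦ hint α β i j]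
  refine Finset.sum_congr rfl fun j _ ↦ ?_
  rw [integral_const_mul]
  congr 1
  exact integral_re (hf α i β j)

/-- A real form that is nonnegative on real rank-one matrices is nonnegative on complex matrices
`c • t ⊗ z` with `t` real. -/
theorem sum_mul_re_inner_nonneg {b : ι → ι → κ → κ → ℝ}
    (hb : ∀ (ξ : κ → ℝ) (η : ι → ℝ),
      0 ≤ ∑ α, ∑ β, ∑ i, ∑ j, b α β i j * ξ i * ξ j * η α * η β)
    (c : ℂ) (t : ι → ℝ) (z : κ → ℂ) :
    0 ≤ ∑ α, ∑ β, ∑ i, ∑ j, b α β i j * (⟪c * (t α * z i), c * (t β * z j)⟫_ℂ).re := by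
  have h := add_nonneg (hb (fun i ↦ (c * z i).re) t) (hb (fun i ↦ (c * z i).im) t)
  simp only [← Finset.sum_add_distrib] at h
  refine h.trans_eq ?_
  refine Finset.sum_congr rfl fun α _ ↦ Finset.sum_congr rfl fun β _ ↦
    Finset.sum_congr rfl fun i _ ↦ Finset.sum_congr rfl fun j _ ↦ ?_
  simp only [RCLike.inner_apply, map_mul, Complex.mul_re, Complex.mul_im, Complex.conj_re,
    Complex.conj_im, Complex.ofReal_re, Complex.ofReal_im]
  ring

end FormIntegral

namespace SchwartzMap

variable {V : Type*} [NormedAddCommGroup V] [InnerProductSpace ℝ V] [FiniteDimensional ℝ V]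
  [MeasurableSpace V] [BorelSpace V]

theorem integrable_inner (f g : 𝓢(V, ℂ)) : Integrable (fun x ↦ ⟪f x, g x⟫_ℂ) :=
  (g.memLp 2).integrable_mul (f.memLp 2).star

theorem fourier_lineDerivOp_apply (f : 𝓢(V, ℂ)) (v ξ : V) :
    𝓕 (∂_{v} f) ξ = (2 * Real.pi * Complex.I) * ((⟪ξ, v⟫_ℝ : ℝ) * 𝓕 f ξ) := by
  have : (inner ℝ · v).HasTemperateGrowth := ((innerSL ℝ).flip v).hasTemperateGrowth
  simp [fourier_lineDerivOp_eq, smulLeftCLM_apply_apply this]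

/-- Gårding's inequality with constant coefficients: a form that is nonnegative on rank-one
matrices has nonnegative integral on gradients. -/
theorem integral_sum_mul_re_inner_lineDerivOp_nonneg {ι κ : Type*} [Fintype ι] [Fintype κ]
    {b : ι → ι → κ → κ → ℝ}
    (hb : ∀ (ξ : κ → ℝ) (η : ι → ℝ),
      0 ≤ ∑ α, ∑ β, ∑ i, ∑ j, b α β i j * ξ i * ξ j * η α * η β)
    (e : ι → V) (f : κ → 𝓢(V, ℂ)) :
    0 ≤ ∫ x, ∑ α, ∑ β, ∑ i, ∑ j, b α β i j * (⟪∂_{e α} (f i) x, ∂_{e β} (f j) x⟫_ℂ).re := by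
  rw [integral_sum_mul_re_inner (f := fun α i x ↦ ∂_{e α} (f i) x)
    fun α i β j ↦ integrable_inner _ _]
  simp_rw [fun α i β j ↦ (integral_inner_fourier_fourier (∂_{e α} (f i)) (∂_{e β} (f j))).symm]
  rw [← integral_sum_mul_re_inner (f := fun α i x ↦ 𝓕 (∂_{e α} (f i)) x)
    fun α i β j ↦ integrable_inner _ _]
  refine integral_nonneg fun ξ ↦ ?_
  simp only [fourier_lineDerivOp_apply]
  exact sum_mul_re_inner_nonneg hb _ _ _

end SchwartzMap

/-- Real version on `ι → ℝ` of `SchwartzMap.integral_sum_mul_re_inner_lineDerivOp_nonneg`. -/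
theorem integral_sum_mul_fderiv_nonneg {ι κ : Type*} [Fintype ι] [DecidableEq ι] [Fintype κ]
    {b : ι → ι → κ → κ → ℝ}
    (hb : ∀ (ξ : κ → ℝ) (η : ι → ℝ),
      0 ≤ ∑ α, ∑ β, ∑ i, ∑ j, b α β i j * ξ i * ξ j * η α * η β)
    {u : (ι → ℝ) → (κ → ℝ)} (hu : ContDiff ℝ (⊤ : ℕ∞) u) (hsupp : HasCompactSupport u) :
    0 ≤ ∫ x, ∑ α, ∑ β, ∑ i, ∑ j,
      b α β i j * fderiv ℝ u x (Pi.single α 1) i * fderiv ℝ u x (Pi.single β 1) j := by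
  let E := EuclideanSpace.equiv ι ℝ
  let L (i : κ) : (κ → ℝ) →L[ℝ] ℂ := Complex.ofRealCLM.comp (ContinuousLinearMap.proj i)
  have hcs (i) : HasCompactSupport fun x ↦ L i (u (E x)) :=
    (hsupp.comp_homeomorph E.toHomeomorph).comp_left (g := L i) (map_zero _)
  have hcd (i) : ContDiff ℝ (⊤ : ℕ∞) fun x ↦ L i (u (E x)) :=
    (L i).contDiff.comp (hu.comp E.contDiff)
  let f (i : κ) : 𝓢(EuclideanSpace ℝ ι, ℂ) := (hcs i).toSchwartzMap (hcd i)
  have hderiv (α i x) : (∂_{EuclideanSpace.single α (1 : ℝ)} (f i) :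
      𝓢(EuclideanSpace ℝ ι, ℂ)) x =
      (fderiv ℝ u (E x) (Pi.single α 1) i : ℝ) := by
    rw [SchwartzMap.lineDerivOp_apply_eq_fderiv]
    have h : HasFDerivAt (f i) ((L i).comp ((fderiv ℝ u (E x)).comp
        (E : EuclideanSpace ℝ ι →L[ℝ] ι → ℝ))) x :=
      (L i).hasFDerivAt.comp x
        (((hu.differentiable (by simp)) (E x)).hasFDerivAt.comp x E.hasFDerivAt)
    rw [h.fderiv]
    rfl
  have h := SchwartzMap.integral_sum_mul_re_inner_lineDerivOp_nonneg hb
    (fun α ↦ EuclideanSpace.single α (1 : ℝ)) f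
  rw [← (PiLp.volume_preserving_ofLp ι).integral_comp
    (MeasurableEquiv.toLp 2 (ι → ℝ)).symm.measurableEmbedding]
  refine h.trans_eq (integral_congr_ae (.of_forall fun x ↦ ?_))
  simp only [hderiv]
  refine Finset.sum_congr rfl fun α _ ↦ Finset.sum_congr rfl fun β _ ↦
    Finset.sum_congr rfl fun i _ ↦ Finset.sum_congr rfl fun j _ ↦ ?_
  simp only [RCLike.inner_apply, Complex.conj_ofReal, ← Complex.ofReal_mul, Complex.ofReal_re]
  change b α β i j * (fderiv ℝ u x.ofLp (Pi.single β 1) j * fderiv ℝ u x.ofLp (Pi.single α 1) i) = _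
  ring

/-- Gårding-type coercivity: if the constant coefficients `a` satisfy the Legendre–Hadamard
condition with constant `θ > 0`, then for every smooth compactly supported `u` with support
in the bounded open set `Ω` (a dense subclass of `H^1_0(Ω)^m`), the energy form dominates
`θ` times the Dirichlet integral. -/
theorem legendre_hadamard_coercivity (N m : ℕ) (Ω : Set (Fin N → ℝ))
    (hΩo : IsOpen Ω) (hΩb : Bornology.IsBounded Ω)
    (θ : ℝ) (hθ : 0 < θ)
    (a : Fin N → Fin N → Fin m → Fin m → ℝ)
    (hLH : ∀ (ξ : Fin m → ℝ) (η : Fin N → ℝ),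
      θ * (∑ i, ξ i ^ 2) * (∑ α, η α ^ 2) ≤
        ∑ α, ∑ β, ∑ i, ∑ j, a α β i j * ξ i * ξ j * η α * η β)
    (u : (Fin N → ℝ) → (Fin m → ℝ))
    (hu : ContDiff ℝ (⊤ : ℕ∞) u) (hsupp : HasCompactSupport u)
    (hsuppΩ : tsupport u ⊆ Ω) :
    θ * ∫ x in Ω, ∑ i, ∑ α, (fderiv ℝ u x (Pi.single α 1) i) ^ 2 ≤
      ∫ x in Ω, ∑ α, ∑ β, ∑ i, ∑ j,
        a α β i j * fderiv ℝ u x (Pi.single α 1) i * fderiv ℝ u x (Pi.single β 1) j := by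

  have hzero {x} (hx : x ∉ Ω) : fderiv ℝ u x = 0 :=
    image_eq_zero_of_notMem_tsupport fun h ↦ hx (hsuppΩ (tsupport_fderiv_subset ℝ h))
  rw [setIntegral_eq_integral_of_forall_compl_eq_zero fun x hx ↦ by simp [hzero hx],
    setIntegral_eq_integral_of_forall_compl_eq_zero fun x hx ↦ by simp [hzero hx]]
  have hcont (α i) : Continuous fun x ↦ fderiv ℝ u x (Pi.single α 1) i :=
    (continuous_apply i).comp ((hu.continuous_fderiv (by simp)).clm_apply continuous_const)
  have hcs (α i) : HasCompactSupport fun x ↦ fderiv ℝ u x (Pi.single α 1) i :=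
    (hsupp.fderiv ℝ).comp_left (g := fun T : (Fin N → ℝ) →L[ℝ] Fin m → ℝ ↦ T (Pi.single α 1) i) rfl
  have hint (α β i j) : Integrable fun x ↦
      fderiv ℝ u x (Pi.single α 1) i * fderiv ℝ u x (Pi.single β 1) j :=
    ((hcont α i).mul (hcont β j)).integrable_of_hasCompactSupport (hcs α i).mul_right
  rw [← integral_const_mul, ← sub_nonneg, ← integral_sub]
  · have h := integral_sum_mul_fderiv_nonneg
      (b := fun α β i j ↦ a α β i j - if α = β then if i = j then θ else 0 else 0) ?_ hu hsupp
    · refine h.trans_eq (integral_congr_ae (.of_forall fun x ↦ ?_))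
      simp only [sub_mul, Finset.sum_sub_distrib, ite_mul, zero_mul, Finset.sum_ite_eq,
        Finset.mem_univ, if_true, Finset.sum_ite_irrel, Finset.sum_const_zero]
      simp only [Finset.mul_sum, pow_two, mul_assoc]
      rw [sub_right_inj]
      exact Finset.sum_comm
    · intro ξ η
      simp only [sub_mul, Finset.sum_sub_distrib, ite_mul, zero_mul, Finset.sum_ite_eq,
        Finset.mem_univ, if_true, Finset.sum_ite_irrel, Finset.sum_const_zero]
      rw [sub_nonneg]
      refine le_trans (le_of_eq ?_) (hLH ξ η)
      rw [mul_assoc, Finset.sum_mul_sum, Finset.sum_comm]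
      simp only [Finset.mul_sum, pow_two, mul_assoc]
  · refine integrable_finsetSum _ fun α _ ↦ integrable_finsetSum _ fun β _ ↦
      integrable_finsetSum _ fun i _ ↦ integrable_finsetSum _ fun j _ ↦ ?_
    simpa only [mul_assoc] using (hint α β i j).const_mul (a α β i j)
  · refine Integrable.const_mul (integrable_finsetSum _ fun i _ ↦
      integrable_finsetSum _ fun α _ ↦ ?_) θ
    simpa only [pow_two] using hint α α i i
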